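/- Let w ∈ W and s ∈ S with l(ws) > l(w). Then in H_x(W): T_{w̲}·(T_s + 1) = T_{(ws)̲} + x·Σ_{v} (T_v + T_{vs}), the sum being over all v ∈ W with v < w and l(vs) < l(v). -/

import Mathlib

/-!
Artin–Tits braid monoid of a finite Coxeter system `(W,S)`, presented with one
generator `𝐰` for each `w ∈ W` and relations `𝐰₁𝐰₂ = 𝐰` when `w = w₁w₂` with
`l(w₁) + l(w₂) = l(w)`.
-/

variable {B : Type*} {W : Type*} [Group W] {M : CoxeterMatrix B}

/-- The defining relations of the braid monoid. -/
def braidRel (cs : CoxeterSystem M W) : FreeMonoid W → FreeMonoid W → Prop := fun a b =>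
  ∃ w₁ w₂ : W, cs.length (w₁ * w₂) = cs.length w₁ + cs.length w₂ ∧
    a = FreeMonoid.of w₁ * FreeMonoid.of w₂ ∧ b = FreeMonoid.of (w₁ * w₂)

/-- The braid monoid `B⁺` of the Coxeter system `cs`. -/
abbrev BraidMonoid (cs : CoxeterSystem M W) := PresentedMonoid (braidRel cs)

/-- The canonical element `𝐰 ∈ B⁺` attached to `w ∈ W`. -/
def bOf (cs : CoxeterSystem M W) (w : W) : BraidMonoid cs := PresentedMonoid.of (braidRel cs) w

/-- The canonical morphism `β : B⁺ → W`, `𝐰 ↦ w`. -/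
noncomputable def bPi (cs : CoxeterSystem M W) : BraidMonoid cs →* W :=
  PresentedMonoid.lift (fun w : W => w) (by
    rintro a b ⟨w₁, w₂, -, rfl, rfl⟩
    simp)

/-- The additive length morphism `l : B⁺ → ℕ` with `l(𝐬) = 1`; recorded as a morphism
to `Multiplicative ℕ`. It sends `𝐰` to `l(w)`. -/
noncomputable def bLen (cs : CoxeterSystem M W) : BraidMonoid cs →* Multiplicative ℕ :=
  PresentedMonoid.lift (fun w : W => Multiplicative.ofAdd (cs.length w)) (by
    rintro a b ⟨w₁, w₂, h, rfl, rfl⟩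
    simp [← ofAdd_add, h])

/-- The set `𝐖 = {b ∈ B⁺ : l(b) = l(β(b))}`, a copy of `W` inside `B⁺`. -/
def bW (cs : CoxeterSystem M W) : Set (BraidMonoid cs) :=
  {b | bLen cs b = Multiplicative.ofAdd (cs.length (bPi cs b))}


/-- The Bruhat order on `W`: `v ≤ w` iff some (equivalently, every) reduced expression
of `w` has a subsequence with product `v`. -/
def bruhatLE (cs : CoxeterSystem M W) (v w : W) : Prop :=
  ∃ ω : List B, cs.wordProd ω = w ∧ ω.length = cs.length w ∧
    ∃ ω' : List B, ω'.Sublist ω ∧ cs.wordProd ω' = v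

/-- The coefficient ring `A = ℤ[x^{1/2}, x^{-1/2}]`, realized as Laurent polynomials
over `ℤ` with variable `x^{1/2}`. -/
abbrev LaurA := LaurentPolynomial ℤ

/-- The element `x = (x^{1/2})²` of `A`. -/
noncomputable def xA : LaurA := LaurentPolynomial.T 2

/-- The monoid algebra `A[B⁺]`. -/
abbrev HeckeCarrier (cs : CoxeterSystem M W) := MonoidAlgebra LaurA (BraidMonoid cs)

/-- The relations defining the Hecke algebra: the generators `(𝐬 + 1)(𝐬 − x)` of the
two-sided ideal are identified with `0`. -/
def heckeRel (cs : CoxeterSystem M W) : HeckeCarrier cs → HeckeCarrier cs → Prop :=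
  fun a b => ∃ i : B,
    a = (MonoidAlgebra.of LaurA (BraidMonoid cs) (bOf cs (cs.simple i)) + 1) *
        (MonoidAlgebra.of LaurA (BraidMonoid cs) (bOf cs (cs.simple i)) -
          algebraMap LaurA (HeckeCarrier cs) xA) ∧
    b = 0

/-- The Iwahori–Hecke algebra `H_x(W)`: the quotient of `A[B⁺]` by the two-sided ideal
generated by the `(𝐬 + 1)(𝐬 − x)`, `s ∈ S`. -/
abbrev Hecke (cs : CoxeterSystem M W) := RingQuot (heckeRel cs)

/-- `T_w`: the image of `𝐰 ∈ B⁺` in `H_x(W)`. -/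
noncomputable def Tmap (cs : CoxeterSystem M W) (w : W) : Hecke cs :=
  RingQuot.mkRingHom (heckeRel cs) (MonoidAlgebra.of LaurA (BraidMonoid cs) (bOf cs w))

open scoped Classical in
/-- `T_{w̲} = Σ_{v ≤ w} T_v`, the sum over the Bruhat order. -/
noncomputable def Tbar [Fintype W] (cs : CoxeterSystem M W) (w : W) : Hecke cs :=
  ∑ v : W, if bruhatLE cs v w then Tmap cs v else 0

/-- The permutation of `W × ZMod 2` attached to a simple reflection `s`: it conjugates the first
coordinate by `s` and flips the second one exactly at `s`. -/
noncomputable def reflPerm (cs : CoxeterSystem M W) (i : B) : Equiv.Perm (W × ZMod 2) :=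
  open scoped Classical in
  Function.Involutive.toPerm
    (fun p => (cs.simple i * p.1 * cs.simple i, p.2 + if p.1 = cs.simple i then 1 else 0)) (by
      rintro ⟨t, e⟩
      have h : cs.simple i * t * cs.simple i = cs.simple i ↔ t = cs.simple i := by
        constructor
        · intro h
          have := congrArg (fun y => cs.simple i * y * cs.simple i) h
          simpa [mul_assoc] using this
        · rintro rfl
          simp
      refine Prod.ext (by simp [mul_assoc]) ?_
      by_cases ht : t = cs.simple i <;> simp [ht, h, add_assoc, CharTwo.add_self_eq_zero])

open scoped Classical in
theorem reflPerm_apply (cs : CoxeterSystem M W) (i : B) (t : W) (e : ZMod 2) :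
    reflPerm cs i (t, e) =
      (cs.simple i * t * cs.simple i, e + if t = cs.simple i then 1 else 0) := rfl

open scoped Classical in
theorem reflPerm_mul_pow_apply (cs : CoxeterSystem M W) (i j : B) (n : ℕ) (t : W) (e : ZMod 2) :
    ((reflPerm cs i * reflPerm cs j) ^ n) (t, e) =
      ((cs.simple i * cs.simple j) ^ n * t * (cs.simple j * cs.simple i) ^ n,
        e + ∑ k ∈ Finset.range (2 * n),
          if t = (cs.simple j * cs.simple i) ^ k * cs.simple j then 1 else 0) := by
  induction n with
  | zero => simp
  | succ n ih =>
    have hinv : ((cs.simple i * cs.simple j) ^ n)⁻¹ = (cs.simple j * cs.simple i) ^ n := by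
      rw [← inv_pow, mul_inv_rev, cs.inv_simple, cs.inv_simple]
    have hsemi : cs.simple j * (cs.simple i * cs.simple j) ^ n =
        (cs.simple j * cs.simple i) ^ n * cs.simple j := by
      have : SemiconjBy (cs.simple j) (cs.simple i * cs.simple j) (cs.simple j * cs.simple i) := by
        simp [SemiconjBy, mul_assoc]
      exact this.pow_right n
    have key : ∀ z : W, (cs.simple i * cs.simple j) ^ n * t * (cs.simple j * cs.simple i) ^ n = z ↔
        t = (cs.simple j * cs.simple i) ^ n * z * (cs.simple i * cs.simple j) ^ n := by
      intro z
      rw [← hinv, mul_inv_eq_iff_eq_mul, ← eq_inv_mul_iff_mul_eq, mul_assoc]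
    have h1 : (cs.simple j * cs.simple i) ^ n * cs.simple j * (cs.simple i * cs.simple j) ^ n =
        (cs.simple j * cs.simple i) ^ (2 * n) * cs.simple j := by
      rw [mul_assoc, hsemi, ← mul_assoc, ← pow_add, two_mul]
    have h2 : (cs.simple j * cs.simple i) ^ n * (cs.simple j * cs.simple i * cs.simple j) *
        (cs.simple i * cs.simple j) ^ n =
        (cs.simple j * cs.simple i) ^ (2 * n + 1) * cs.simple j := by
      rw [mul_assoc, mul_assoc (cs.simple j * cs.simple i), hsemi, ← mul_assoc, ← mul_assoc,
        ← pow_succ, ← pow_add]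
      congr 2
      omega
    have h3 : ∀ y : W, cs.simple j * y * cs.simple j = cs.simple i ↔
        y = cs.simple j * cs.simple i * cs.simple j := by
      intro y
      constructor
      · intro h
        rw [← h]
        simp [mul_assoc]
      · rintro rfl
        simp [mul_assoc]
    rw [pow_succ', Equiv.Perm.mul_apply, ih, Equiv.Perm.mul_apply, reflPerm_apply, reflPerm_apply]
    refine Prod.ext ?_ ?_
    · simp only [pow_succ' (cs.simple i * cs.simple j), pow_succ (cs.simple j * cs.simple i),
        mul_assoc]
    · simp only [h3, key, h1, h2]
      rw [show 2 * (n + 1) = 2 * n + 1 + 1 by ring, Finset.sum_range_succ, Finset.sum_range_succ,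
        add_assoc, add_assoc, add_assoc]

theorem reflPerm_isLiftable (cs : CoxeterSystem M W) : M.IsLiftable (reflPerm cs) := by
  classical
  intro i j
  have hij := cs.simple_mul_simple_pow i j
  have hji := cs.simple_mul_simple_pow' i j
  ext1 ⟨t, e⟩
  rw [reflPerm_mul_pow_apply, two_mul, Finset.sum_range_add]
  simp [pow_add, hij, hji, CharTwo.add_self_eq_zero]

/-- The action of `W` on `W × ZMod 2` extending `reflPerm`. -/
noncomputable def reflAction (cs : CoxeterSystem M W) : W →* Equiv.Perm (W × ZMod 2) :=
  cs.lift ⟨reflPerm cs, reflPerm_isLiftable cs⟩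

theorem reflAction_simple (cs : CoxeterSystem M W) (i : B) :
    reflAction cs (cs.simple i) = reflPerm cs i :=
  cs.lift_apply_simple (reflPerm_isLiftable cs) i

open scoped Classical in
theorem reflAction_wordProd_apply (cs : CoxeterSystem M W) (ω : List B) (t : W) (e : ZMod 2) :
    reflAction cs (cs.wordProd ω) (t, e) =
      (cs.wordProd ω * t * (cs.wordProd ω)⁻¹, e + ((cs.rightInvSeq ω).count t : ZMod 2)) := by
  induction ω with
  | nil => simp
  | cons i ω ih =>
    have h : cs.wordProd ω * t * (cs.wordProd ω)⁻¹ = cs.simple i ↔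
        (cs.wordProd ω)⁻¹ * cs.simple i * cs.wordProd ω = t := by
      constructor
      · intro h
        rw [← h]
        group
      · rintro rfl
        group
    rw [cs.wordProd_cons, map_mul, Equiv.Perm.mul_apply, ih, reflAction_simple, reflPerm_apply, h]
    refine Prod.ext ?_ ?_
    · simp [mul_assoc]
    · simp only [CoxeterSystem.rightInvSeq, List.count_cons, beq_iff_eq]
      push_cast
      rw [add_assoc]

/-- The parity of the number of occurrences of `t` in the right inversion sequence of any word
for `w`. -/
noncomputable def reflParity (cs : CoxeterSystem M W) (w t : W) : ZMod 2 :=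
  (reflAction cs w (t, 0)).2

open scoped Classical in
theorem reflParity_wordProd (cs : CoxeterSystem M W) (ω : List B) (t : W) :
    reflParity cs (cs.wordProd ω) t = ((cs.rightInvSeq ω).count t : ZMod 2) := by
  simp [reflParity, reflAction_wordProd_apply]

theorem reflAction_apply (cs : CoxeterSystem M W) (w t : W) (e : ZMod 2) :
    reflAction cs w (t, e) = (w * t * w⁻¹, e + reflParity cs w t) := by
  classical
  obtain ⟨ω, rfl⟩ := cs.wordProd_surjective w
  rw [reflParity_wordProd, reflAction_wordProd_apply]

theorem reflParity_mul (cs : CoxeterSystem M W) (u v t : W) :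
    reflParity cs (u * v) t = reflParity cs v t + reflParity cs u (v * t * v⁻¹) := by
  rw [reflParity, map_mul, Equiv.Perm.mul_apply, reflAction_apply, reflAction_apply]
  simp

theorem reflParity_one (cs : CoxeterSystem M W) (t : W) : reflParity cs 1 t = 0 := by
  simp [reflParity]

theorem reflParity_simple_self (cs : CoxeterSystem M W) (i : B) :
    reflParity cs (cs.simple i) (cs.simple i) = 1 := by
  simp [reflParity, reflAction_simple, reflPerm_apply]

theorem reflParity_self (cs : CoxeterSystem M W) {t : W} (ht : cs.IsReflection t) :
    reflParity cs t t = 1 := by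
  obtain ⟨x, i, rfl⟩ := ht
  have h := reflParity_mul cs x x⁻¹ (x * cs.simple i * x⁻¹)
  rw [mul_inv_cancel, reflParity_one] at h
  have e1 : x⁻¹ * (x * cs.simple i * x⁻¹) * x⁻¹⁻¹ = cs.simple i := by group
  rw [e1] at h
  rw [reflParity_mul, reflParity_mul, e1, reflParity_simple_self]
  simp only [mul_inv_cancel_right]
  linear_combination -h

theorem mem_rightInvSeq_of_reflParity_ne_zero (cs : CoxeterSystem M W) (ω : List B) (t : W)
    (h : reflParity cs (cs.wordProd ω) t ≠ 0) : t ∈ cs.rightInvSeq ω := by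
  classical
  by_contra hn
  exact h (by simp [reflParity_wordProd, List.count_eq_zero_of_not_mem hn])

theorem strong_exchange (cs : CoxeterSystem M W) (ω : List B) {t : W}
    (h : cs.IsRightInversion (cs.wordProd ω) t) : t ∈ cs.rightInvSeq ω := by
  apply mem_rightInvSeq_of_reflParity_ne_zero
  intro h0
  obtain ⟨ht, hlt⟩ := h
  obtain ⟨ω', hω', hw⟩ := cs.exists_isReduced (cs.wordProd ω * t)
  have h1 : reflParity cs (cs.wordProd ω') t ≠ 0 := by
    rw [← hw, reflParity_mul, reflParity_self cs ht, mul_inv_cancel_right, h0]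
    simp
  have h2 := (cs.isRightInversion_of_mem_rightInvSeq hω'
    (mem_rightInvSeq_of_reflParity_ne_zero cs ω' t h1)).2
  rw [← hw, mul_assoc, ht.mul_self, mul_one] at h2
  omega

/-- One step down by a reflection: `u = w t` with `t` a right inversion of `w`. -/
def reflStep (cs : CoxeterSystem M W) (u w : W) : Prop :=
  ∃ t, cs.IsRightInversion w t ∧ u = w * t

theorem exists_sublist_of_reflStep (cs : CoxeterSystem M W) {u w : W} (h : reflStep cs u w)
    (ω : List B) (hω : cs.wordProd ω = w) : ∃ ω' : List B, ω'.Sublist ω ∧ cs.wordProd ω' = u := by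
  obtain ⟨t, ht, rfl⟩ := h
  subst hω
  obtain ⟨j, hj, rfl⟩ := List.mem_iff_getElem.mp (strong_exchange cs ω ht)
  refine ⟨ω.eraseIdx j, List.eraseIdx_sublist .., ?_⟩
  rw [← cs.wordProd_mul_getD_rightInvSeq, List.getD_eq_getElem _ _ hj]

theorem exists_sublist_of_reflTransGen (cs : CoxeterSystem M W) {u w : W}
    (h : Relation.ReflTransGen (reflStep cs) u w) (ω : List B) (hω : cs.wordProd ω = w) :
    ∃ ω' : List B, ω'.Sublist ω ∧ cs.wordProd ω' = u := by
  induction h using Relation.ReflTransGen.head_induction_on with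
  | refl => exact ⟨ω, List.Sublist.refl _, hω⟩
  | head hstep _ ih =>
    obtain ⟨ω', hs, hp⟩ := ih
    obtain ⟨ω'', hs', hp'⟩ := exists_sublist_of_reflStep cs hstep ω' hp
    exact ⟨ω'', hs'.trans hs, hp'⟩

theorem reflStep_mul_simple (cs : CoxeterSystem M W) {w : W} {i : B}
    (h : cs.length w < cs.length (w * cs.simple i)) : reflStep cs w (w * cs.simple i) :=
  ⟨cs.simple i, ⟨cs.isReflection_simple i, by simpa using h⟩, by simp⟩

theorem reflStep_right_mul (cs : CoxeterSystem M W) {u w : W} (h : reflStep cs u w) (i : B) :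
    Relation.ReflTransGen (reflStep cs) (u * cs.simple i) w ∨
      Relation.ReflTransGen (reflStep cs) (u * cs.simple i) (w * cs.simple i) := by
  obtain ⟨t, ⟨ht, hlt⟩, rfl⟩ := h
  have ht' : cs.IsReflection (cs.simple i * t * cs.simple i) := by
    simpa using ht.conj (cs.simple i)
  rcases lt_or_ge (cs.length (w * t * cs.simple i)) (cs.length (w * cs.simple i)) with hl | hl
  · right
    have e : w * t * cs.simple i = w * cs.simple i * (cs.simple i * t * cs.simple i) := by
      simp [mul_assoc]
    exact .single ⟨_, ⟨ht', e ▸ hl⟩, e⟩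
  · left
    have e : w * t * cs.simple i * (cs.simple i * t * cs.simple i) = w * cs.simple i := by
      have := ht.mul_self
      simp only [mul_assoc, cs.simple_mul_simple_cancel_left]
      rw [← mul_assoc t, this, one_mul]
    obtain ⟨ω, hω, hw⟩ := cs.exists_isReduced (w * t)
    have hne := ht'.length_mul_left_ne (w * t * cs.simple i)
    rw [e] at hne
    have hmem := strong_exchange cs (ω.concat i) (t := cs.simple i * t * cs.simple i)
      ⟨ht', by rw [cs.wordProd_concat, ← hw, e]; omega⟩
    rw [cs.rightInvSeq_concat] at hmem
    simp only [List.concat_eq_append, List.mem_append, List.mem_map, List.mem_singleton] at hmem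
    rcases hmem with ⟨y, hy, hyt⟩ | hs
    · have hyt' : y = t := by simpa [mul_assoc] using hyt
      subst hyt'
      have := (cs.isRightInversion_of_mem_rightInvSeq hω hy).2
      rw [← hw, mul_assoc, ht.mul_self, mul_one] at this
      omega
    · have hts : t = cs.simple i := by
        have := congrArg (fun y => cs.simple i * y * cs.simple i) hs
        simpa [mul_assoc] using this
      subst hts
      simpa using Relation.ReflTransGen.refl

theorem reflTransGen_right_mul (cs : CoxeterSystem M W) {u w : W}
    (h : Relation.ReflTransGen (reflStep cs) u w) (i : B) :
    Relation.ReflTransGen (reflStep cs) (u * cs.simple i) w ∨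
      Relation.ReflTransGen (reflStep cs) (u * cs.simple i) (w * cs.simple i) := by
  induction h using Relation.ReflTransGen.head_induction_on with
  | refl => exact .inr .refl
  | head hstep hvw ih =>
    rcases reflStep_right_mul cs hstep i with h | h
    · exact .inl (h.trans hvw)
    · exact ih.imp h.trans h.trans

theorem reflTransGen_of_sublist (cs : CoxeterSystem M W) (ω : List B) (hω : cs.IsReduced ω)
    {ω' : List B} (h : ω'.Sublist ω) :
    Relation.ReflTransGen (reflStep cs) (cs.wordProd ω') (cs.wordProd ω) := by
  induction ω using List.reverseRecOn generalizing ω' with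
  | nil =>
    rw [List.sublist_nil.mp h]
  | append_singleton ω i ih =>
    have hr : cs.IsReduced ω := by simpa using hω.take ω.length
    have hlt : cs.length (cs.wordProd ω) < cs.length (cs.wordProd ω * cs.simple i) := by
      have h1 := hω.eq
      rw [cs.wordProd_append, cs.wordProd_singleton] at h1
      rw [h1, hr.eq]
      simp
    rw [cs.wordProd_append, cs.wordProd_singleton]
    have hstep := reflStep_mul_simple cs hlt
    obtain ⟨l₁, l₂, rfl, h₁, h₂⟩ := List.sublist_append_iff.mp h
    rcases List.sublist_singleton.mp h₂ with rfl | rfl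
    · simpa using (ih hr h₁).tail hstep
    · rw [cs.wordProd_append, cs.wordProd_singleton]
      exact (reflTransGen_right_mul cs (ih hr h₁) i).elim (·.tail hstep) id

theorem bruhatLE_iff_reflTransGen (cs : CoxeterSystem M W) {u w : W} :
    bruhatLE cs u w ↔ Relation.ReflTransGen (reflStep cs) u w := by
  constructor
  · rintro ⟨ω, rfl, hl, ω', hs, rfl⟩
    exact reflTransGen_of_sublist cs ω hl.symm hs
  · intro h
    obtain ⟨ω, hω, rfl⟩ := cs.exists_isReduced w
    exact ⟨ω, rfl, hω.symm, exists_sublist_of_reflTransGen cs h ω rfl⟩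

theorem bruhatLE_of_mul_simple (cs : CoxeterSystem M W) {v w : W} {i : B}
    (hv : cs.length v < cs.length (v * cs.simple i)) (h : bruhatLE cs (v * cs.simple i) w) :
    bruhatLE cs v w := by
  rw [bruhatLE_iff_reflTransGen] at h ⊢
  exact .head (reflStep_mul_simple cs hv) h

theorem bruhatLE_or_of_le_mul_simple (cs : CoxeterSystem M W) {u w : W} {i : B}
    (h : bruhatLE cs u (w * cs.simple i)) :
    bruhatLE cs u w ∨ bruhatLE cs (u * cs.simple i) w := by
  obtain ⟨ω, hω, rfl⟩ := cs.exists_isReduced w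
  obtain ⟨ω', hs, rfl⟩ := exists_sublist_of_reflTransGen cs
    ((bruhatLE_iff_reflTransGen cs).mp h) (ω ++ [i])
    (by rw [cs.wordProd_append, cs.wordProd_singleton])
  obtain ⟨l₁, l₂, rfl, h₁, h₂⟩ := List.sublist_append_iff.mp hs
  rcases List.sublist_singleton.mp h₂ with rfl | rfl
  · exact .inl ⟨ω, rfl, hω.symm, l₁, h₁, by simp⟩
  · refine .inr ⟨ω, rfl, hω.symm, l₁, h₁, ?_⟩
    rw [cs.wordProd_append, cs.wordProd_singleton, cs.simple_mul_simple_cancel_right]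

theorem bruhatLE_mul_simple_iff (cs : CoxeterSystem M W) {v w : W} {i : B}
    (hw : cs.length w < cs.length (w * cs.simple i))
    (hv : cs.length v < cs.length (v * cs.simple i)) :
    bruhatLE cs v (w * cs.simple i) ↔ bruhatLE cs v w := by
  constructor
  · exact fun h => (bruhatLE_or_of_le_mul_simple cs h).elim id (bruhatLE_of_mul_simple cs hv)
  · simp only [bruhatLE_iff_reflTransGen]
    exact fun h => h.tail (reflStep_mul_simple cs hw)

theorem mul_simple_bruhatLE_mul_simple_iff (cs : CoxeterSystem M W) {v w : W} {i : B}
    (hw : cs.length w < cs.length (w * cs.simple i))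
    (hv : cs.length v < cs.length (v * cs.simple i)) :
    bruhatLE cs (v * cs.simple i) (w * cs.simple i) ↔ bruhatLE cs v w := by
  constructor
  · intro h
    exact (bruhatLE_mul_simple_iff cs hw hv).mp (bruhatLE_of_mul_simple cs hv h)
  · simp only [bruhatLE_iff_reflTransGen]
    exact fun h => (reflTransGen_right_mul cs h i).elim (·.tail (reflStep_mul_simple cs hw)) id

theorem Tmap_mul (cs : CoxeterSystem M W) {u v : W}
    (h : cs.length (u * v) = cs.length u + cs.length v) :
    Tmap cs u * Tmap cs v = Tmap cs (u * v) := by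
  have hb : bOf cs u * bOf cs v = bOf cs (u * v) :=
    Quotient.sound (ConGen.Rel.of _ _ ⟨u, v, h, rfl, rfl⟩)
  rw [Tmap, Tmap, Tmap, ← map_mul, ← map_mul, hb]

theorem Tmap_simple_quadratic (cs : CoxeterSystem M W) (i : B) :
    (Tmap cs (cs.simple i) + 1) * Tmap cs (cs.simple i) =
      (Tmap cs (cs.simple i) + 1) * algebraMap LaurA (Hecke cs) xA := by
  have h := RingQuot.mkRingHom_rel (r := heckeRel cs) ⟨i, rfl, rfl⟩
  have hx : RingQuot.mkRingHom (heckeRel cs) (algebraMap LaurA (HeckeCarrier cs) xA) =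
      algebraMap LaurA (Hecke cs) xA := by
    rw [← RingQuot.mkAlgHom_coe LaurA]
    exact (RingQuot.mkAlgHom LaurA (heckeRel cs)).commutes xA
  have hsub : ∀ a c : HeckeCarrier cs, (a + 1) * a = (a + 1) * (a - c) + (a + 1) * c := by
    intro a c
    rw [← mul_add, sub_add_cancel]
  have h' := congrArg (RingQuot.mkRingHom (heckeRel cs))
    (hsub (MonoidAlgebra.of LaurA (BraidMonoid cs) (bOf cs (cs.simple i)))
      (algebraMap LaurA (HeckeCarrier cs) xA))
  rw [map_add, h, map_zero, zero_add, map_mul, map_mul, map_add, map_one, hx] at h'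
  exact h'

theorem Tmap_mul_simple_add_one_of_lt (cs : CoxeterSystem M W) {v : W} {i : B}
    (hv : cs.length v < cs.length (v * cs.simple i)) :
    Tmap cs v * (Tmap cs (cs.simple i) + 1) = Tmap cs v + Tmap cs (v * cs.simple i) := by
  have h1 : cs.length (v * cs.simple i) = cs.length v + cs.length (cs.simple i) := by
    rw [cs.length_simple]
    rcases cs.length_mul_simple v i with h | h <;> omega
  rw [mul_add, Tmap_mul cs h1, mul_one, add_comm]

theorem Tmap_mul_simple_add_one_of_gt (cs : CoxeterSystem M W) {v : W} {i : B}
    (hv : cs.length (v * cs.simple i) < cs.length v) :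
    Tmap cs v * (Tmap cs (cs.simple i) + 1) =
      algebraMap LaurA (Hecke cs) xA * (Tmap cs v + Tmap cs (v * cs.simple i)) := by
  have h2 : cs.length (v * cs.simple i) < cs.length (v * cs.simple i * cs.simple i) := by
    simpa using hv
  have h3 := Tmap_mul_simple_add_one_of_lt cs h2
  have h4 : Tmap cs v = Tmap cs (v * cs.simple i) * Tmap cs (cs.simple i) := by
    rw [Tmap_mul cs, cs.simple_mul_simple_cancel_right]
    rw [cs.simple_mul_simple_cancel_right, cs.length_simple]
    rcases cs.length_mul_simple v i with h | h <;> omega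
  have hc : Tmap cs (cs.simple i) * (Tmap cs (cs.simple i) + 1) =
      (Tmap cs (cs.simple i) + 1) * Tmap cs (cs.simple i) := by
    rw [mul_add, add_mul, mul_one, one_mul]
  rw [(Algebra.commutes xA (Tmap cs v + Tmap cs (v * cs.simple i)))]
  nth_rewrite 1 [h4]
  rw [mul_assoc, hc, Tmap_simple_quadratic, ← mul_assoc, h3]
  simp [add_comm]

open scoped Classical in
/-- If `w ∈ W` and `s ∈ S` satisfy `l(ws) > l(w)`, then in `H_x(W)`
one has `T_{w̲}·(T_s + 1) = T_{(ws)̲} + x·Σ_v (T_v + T_{vs})`, the sum being over all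
`v ∈ W` with `v < w` and `l(vs) < l(v)`. -/
theorem stmt16 [Fintype W] (cs : CoxeterSystem M W) (w : W) (i : B)
    (h : cs.length w < cs.length (w * cs.simple i)) :
    Tbar cs w * (Tmap cs (cs.simple i) + 1) =
      Tbar cs (w * cs.simple i) +
        algebraMap LaurA (Hecke cs) xA *
          ∑ v : W,
            if bruhatLE cs v w ∧ v ≠ w ∧ cs.length (v * cs.simple i) < cs.length v
            then Tmap cs v + Tmap cs (v * cs.simple i) else 0 := by
  have hdesc : ∀ v : W, (cs.length v < cs.length (v * cs.simple i)) ↔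
      ¬ cs.length (v * cs.simple i) < cs.length v := fun v => by
    have := cs.length_mul_simple_ne v i
    omega
  have hL : Tbar cs w * (Tmap cs (cs.simple i) + 1) =
      (∑ v : W, if bruhatLE cs v w ∧ cs.length v < cs.length (v * cs.simple i)
        then Tmap cs v + Tmap cs (v * cs.simple i) else 0) +
      algebraMap LaurA (Hecke cs) xA *
          ∑ v : W,
            if bruhatLE cs v w ∧ v ≠ w ∧ cs.length (v * cs.simple i) < cs.length v
            then Tmap cs v + Tmap cs (v * cs.simple i) else 0 := by
    rw [Tbar, Finset.sum_mul, Finset.mul_sum, ← Finset.sum_add_distrib]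
    refine Finset.sum_congr rfl fun v _ => ?_
    by_cases hvw : bruhatLE cs v w
    · by_cases hv : cs.length v < cs.length (v * cs.simple i)
      · rw [if_pos hvw, if_pos ⟨hvw, hv⟩, if_neg fun hn => (hdesc v).mp hv hn.2.2, mul_zero,
          add_zero, Tmap_mul_simple_add_one_of_lt cs hv]
      · have hv' : cs.length (v * cs.simple i) < cs.length v := by
          rw [hdesc, not_not] at hv
          exact hv
        have hne : v ≠ w := by
          rintro rfl
          exact hv h
        rw [if_pos hvw, if_neg fun hn => hv hn.2, if_pos ⟨hvw, hne, hv'⟩, zero_add,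
          Tmap_mul_simple_add_one_of_gt cs hv']
    · simp [hvw]
  have hR : Tbar cs (w * cs.simple i) =
      ∑ v : W, if bruhatLE cs v w ∧ cs.length v < cs.length (v * cs.simple i)
        then Tmap cs v + Tmap cs (v * cs.simple i) else 0 := by
    have hsplit : Tbar cs (w * cs.simple i) =
        (∑ v : W, if bruhatLE cs v (w * cs.simple i) ∧ cs.length v < cs.length (v * cs.simple i)
          then Tmap cs v else 0) +
        ∑ v : W, if bruhatLE cs v (w * cs.simple i) ∧ cs.length (v * cs.simple i) < cs.length v
          then Tmap cs v else 0 := by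
      rw [Tbar, ← Finset.sum_add_distrib]
      refine Finset.sum_congr rfl fun v _ => ?_
      by_cases hv : cs.length (v * cs.simple i) < cs.length v <;> simp [hdesc, hv]
    rw [hsplit, ← Equiv.sum_comp (Equiv.mulRight (cs.simple i)) (fun v : W =>
      if bruhatLE cs v (w * cs.simple i) ∧ cs.length (v * cs.simple i) < cs.length v
        then Tmap cs v else 0), ← Finset.sum_add_distrib]
    refine Finset.sum_congr rfl fun v _ => ?_
    by_cases hv : cs.length v < cs.length (v * cs.simple i)
    · by_cases hvw : bruhatLE cs v w <;>
        simp [hv, hvw, bruhatLE_mul_simple_iff cs h hv, mul_simple_bruhatLE_mul_simple_iff cs h hv]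
    · simp [hv]
  rw [hL, hR]
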